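/- arXiv:1812.02876 — 4 statements merged into one kernel-verified Lean document; each statement's English description precedes it below -/
import Mathlib

section
/- Let X ⊂ ℝ^d (d ≥ 2) be a bounded open set with smooth boundary and let 0 < α ≤ ᾱ < ∞. There exist constants c > 0 and c̃ > 0, depending only on X, d, α, ᾱ, such that the following holds: for all γ, γ̃ ∈ C²(X̄) with α ≤ γ, γ̃ ≤ ᾱ, and all Γ, Γ̃, σ_a, σ̃_a continuous on X̄ with values in [α, ᾱ], if the two coefficient triples satisfy, pointwise on X, the relations (i) Γ̃σ̃_a/√γ̃ = Γσ_a/√γ and (ii) Δ√γ̃/√γ̃ + σ̃_a/γ̃ = Δ√γ/√γ + σ_a/γ, then c ‖√γ̃ − √γ‖_{L²(X)} ≤ ‖σ̃_a − σ_a‖_{L²(X)} + ‖Γ̃σ̃_a − Γσ_a‖_{L²(X)} ≤ c̃ ( ‖γ̃ − γ‖_{L²(X)} + ‖Δ√γ̃/√γ̃ − Δ√γ/√γ‖_{L²(X)} ). (This is the paper's Theorem 2.7 on simultaneous reconstruction of (Γ, σ_a) under uncertainty in γ; the paper shows that relations (i) and (ii) are exactly what equality of the internal data from two well-chosen illuminations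 forces on the two reconstructed coefficient triples, since the quantity μ = √γ/(Γσ_a) and the potential q = −(Δ√γ/√γ + σ_a/γ) are determined by the data.) -/
open MeasureTheory

noncomputable section

/-- Euclidean space ℝ^d. -/
abbrev Euc (d : ℕ) : Type := EuclideanSpace ℝ (Fin d)

/-- Divergence of a vector field on Euclidean space: `∇·F = ∑ i ∂Fᵢ/∂xᵢ`. -/
def vdiv {d : ℕ} (F : Euc d → Euc d) (x : Euc d) : ℝ :=
  ∑ i : Fin d, fderiv ℝ (fun y => F y i) x (EuclideanSpace.single i (1 : ℝ))

/-- Laplacian `Δf = ∇·(∇f)`. -/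
def lap {d : ℕ} (f : Euc d → ℝ) (x : Euc d) : ℝ :=
  vdiv (fun y => gradient f y) x

/-- L² norm of `f` over `X`: `(∫_X f² dx)^{1/2}`. -/
def L2norm {d : ℕ} (X : Set (Euc d)) (f : Euc d → ℝ) : ℝ :=
  (∫ x in X, (f x) ^ 2) ^ (1 / 2 : ℝ)

/-- H¹ norm of `f` over `X`: `(∫_X (f² + |∇f|²) dx)^{1/2}`. -/
def H1norm {d : ℕ} (X : Set (Euc d)) (f : Euc d → ℝ) : ℝ :=
  (∫ x in X, ((f x) ^ 2 + ‖gradient f x‖ ^ 2)) ^ (1 / 2 : ℝ)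

/-- `X` has smooth boundary: it is the strict sublevel set of a smooth defining
function whose differential does not vanish on the boundary. -/
def HasSmoothBoundary {d : ℕ} (X : Set (Euc d)) : Prop :=
  ∃ φ : Euc d → ℝ, ContDiff ℝ (⊤ : ℕ∞) φ ∧ X = {x | φ x < 0} ∧
    ∀ x ∈ frontier X, fderiv ℝ φ x ≠ 0

theorem aux_L2 {d : ℕ} {X : Set (Euc d)} (hX : MeasurableSet X) {f g h : Euc d → ℝ} {K : ℝ}
    (hK : 0 ≤ K) (hg : IntegrableOn (fun x => g x ^ 2) X) (hh : IntegrableOn (fun x => h x ^ 2) X)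
    (hfgh : ∀ x ∈ X, |f x| ≤ K * (|g x| + |h x|)) :
    L2norm X f ≤ 2 * K * (L2norm X g + L2norm X h) := by
  unfold L2norm
  simp only [← Real.sqrt_eq_rpow]
  have hG : 0 ≤ ∫ x in X, g x ^ 2 := integral_nonneg fun x => sq_nonneg _
  have hH : 0 ≤ ∫ x in X, h x ^ 2 := integral_nonneg fun x => sq_nonneg _
  have h1 : ∫ x in X, f x ^ 2 ≤ ∫ x in X, (2 * K ^ 2) * (g x ^ 2 + h x ^ 2) := by
    apply integral_mono_of_nonneg
    · exact Filter.Eventually.of_forall fun x => sq_nonneg _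
    · exact (hg.add hh).const_mul _
    · filter_upwards [ae_restrict_mem hX] with x hx
      have h2 := hfgh x hx
      have h3 : |f x| ^ 2 ≤ (K * (|g x| + |h x|)) ^ 2 := by gcongr
      rw [sq_abs] at h3
      rw [← sq_abs (g x), ← sq_abs (h x)]
      nlinarith [mul_nonneg (sq_nonneg K) (sq_nonneg (|g x| - |h x|))]
  rw [integral_const_mul, integral_add hg hh] at h1
  apply Real.sqrt_le_iff.2
  refine ⟨by positivity, h1.trans ?_⟩
  set G := ∫ x in X, g x ^ 2
  set H := ∫ x in X, h x ^ 2
  have e1 := Real.sq_sqrt hG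
  have e2 := Real.sq_sqrt hH
  have p : 0 ≤ √G * √H := by positivity
  have : G + H ≤ (√G + √H) ^ 2 := by nlinarith
  calc 2 * K ^ 2 * (G + H) ≤ 2 * K ^ 2 * (√G + √H) ^ 2 := by gcongr
    _ ≤ _ := by nlinarith [mul_nonneg (sq_nonneg K) (sq_nonneg (√G + √H))]

theorem aux_int {d : ℕ} {X : Set (Euc d)} (hXbd : Bornology.IsBounded X) {f : Euc d → ℝ}
    (hf : ContinuousOn f (closure X)) : IntegrableOn f X :=
  (hf.integrableOn_compact hXbd.isCompact_closure).mono_set subset_closure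

theorem aux_pt {α β g gt G Gt s st : ℝ} (hα : 0 < α)
    (hg : α ≤ g ∧ g ≤ β) (hgt : α ≤ gt ∧ gt ≤ β) (hG : α ≤ G ∧ G ≤ β)
    (hs : α ≤ s ∧ s ≤ β)
    (h : Gt * st / √gt = G * s / √g) :
    |√gt - √g| ≤ √β / α ^ 2 * |Gt * st - G * s| ∧
    |Gt * st - G * s| ≤ β ^ 2 / α * |gt - g| := by
  have g0 : 0 < √g := Real.sqrt_pos.2 (by linarith)
  have gt0 : 0 < √gt := Real.sqrt_pos.2 (by linarith)
  have e1 : √g ^ 2 = g := Real.sq_sqrt (by linarith)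
  have e2 : √gt ^ 2 = gt := Real.sq_sqrt (by linarith)
  have hb : √g ≤ √β := Real.sqrt_le_sqrt hg.2
  have hG0 : 0 < G := by linarith
  have hs0 : 0 < s := by linarith
  have hl : α ^ 2 ≤ G * s := by nlinarith
  have hu : G * s ≤ β ^ 2 := by nlinarith
  have hm : Gt * st - G * s = G * s / √g * (√gt - √g) := by
    rw [div_eq_iff gt0.ne'] at h
    rw [h]; field_simp
  have hM : 0 < G * s / √g := by positivity
  rw [hm, abs_mul, abs_of_pos hM]
  constructor
  · have : 1 ≤ √β / α ^ 2 * (G * s / √g) := by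
      rw [div_mul_div_comm, le_div_iff₀ (by positivity)]
      nlinarith [mul_le_mul hb hl (by positivity) (by positivity)]
    nlinarith [abs_nonneg (√gt - √g)]
  · have e : gt - g = (√gt - √g) * (√gt + √g) := by nlinarith
    rw [e, abs_mul, abs_of_pos (add_pos gt0 g0)]
    have : G * s / √g ≤ β ^ 2 / α * (√gt + √g) := by
      rw [div_le_iff₀ g0]
      have h3 : 1 ≤ (√gt + √g) * √g / α := by
        rw [le_div_iff₀ hα]; nlinarith [mul_pos gt0 g0]
      calc G * s ≤ β ^ 2 * 1 := by linarith
        _ ≤ β ^ 2 * ((√gt + √g) * √g / α) := by gcongr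
        _ = _ := by ring
    nlinarith [abs_nonneg (√gt - √g)]

theorem aux_pt2 {α β g gt s st l lt : ℝ} (hα : 0 < α)
    (hg : α ≤ g ∧ g ≤ β) (hgt : α ≤ gt ∧ gt ≤ β)
    (hs : α ≤ s ∧ s ≤ β) (h : lt + st / gt = l + s / g) :
    |st - s| ≤ (β / α + β) * (|gt - g| + |lt - l|) := by
  have g0 : 0 < g := by linarith
  have gt0 : 0 < gt := by linarith
  have s0 : 0 < s := by linarith
  have b0 : 0 < β := by linarith
  have e : st - s = s / g * (gt - g) - gt * (lt - l) := by
    have : st = gt * (l + s / g - lt) := by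
      rw [← h]; field_simp; ring
    rw [this]; field_simp; ring
  have h1 : |st - s| ≤ s / g * |gt - g| + gt * |lt - l| := by
    rw [e]
    refine (abs_sub _ _).trans ?_
    rw [abs_mul, abs_mul, abs_of_pos gt0, abs_of_pos (div_pos s0 g0)]
  have h2 : s / g ≤ β / α := div_le_div₀ b0.le hs.2 hα hg.1
  have h3 : s / g * |gt - g| ≤ β / α * |gt - g| := by gcongr
  have h4 : gt * |lt - l| ≤ β * |lt - l| := by gcongr; exact hgt.2
  have h5 : 0 ≤ β * |gt - g| := by positivity
  have h6 : 0 ≤ β / α * |lt - l| := by positivity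
  nlinarith

/-- paper Thm 2.7: two-sided stability for simultaneous reconstruction
of (Γ, σₐ) under uncertainty in the diffusion coefficient γ, given that the two
coefficient triples produce the same μ = √γ/(Γσₐ) and q = −(Δ√γ/√γ + σₐ/γ). -/
theorem simultaneous_reconstruction_stability
    (d : ℕ) (hd : 2 ≤ d) (X : Set (Euc d)) (hXopen : IsOpen X)
    (hXbd : Bornology.IsBounded X) (hXsm : HasSmoothBoundary X)
    (α ᾱ : ℝ) (hα : 0 < α) (hαᾱ : α ≤ ᾱ) :
    ∃ c ct : ℝ, 0 < c ∧ 0 < ct ∧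
      ∀ γ γt Γ Γt σa σat : Euc d → ℝ,
        ContDiffOn ℝ 2 γ (closure X) → ContDiffOn ℝ 2 γt (closure X) →
        (∀ x ∈ closure X, α ≤ γ x ∧ γ x ≤ ᾱ) →
        (∀ x ∈ closure X, α ≤ γt x ∧ γt x ≤ ᾱ) →
        ContinuousOn Γ (closure X) → ContinuousOn Γt (closure X) →
        (∀ x ∈ closure X, α ≤ Γ x ∧ Γ x ≤ ᾱ) →
        (∀ x ∈ closure X, α ≤ Γt x ∧ Γt x ≤ ᾱ) →
        ContinuousOn σa (closure X) → ContinuousOn σat (closure X) →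
        (∀ x ∈ closure X, α ≤ σa x ∧ σa x ≤ ᾱ) →
        (∀ x ∈ closure X, α ≤ σat x ∧ σat x ≤ ᾱ) →
        -- (i) Γ̃σ̃ₐ/√γ̃ = Γσₐ/√γ on X
        (∀ x ∈ X, Γt x * σat x / Real.sqrt (γt x) = Γ x * σa x / Real.sqrt (γ x)) →
        -- (ii) Δ√γ̃/√γ̃ + σ̃ₐ/γ̃ = Δ√γ/√γ + σₐ/γ on X
        (∀ x ∈ X,
          lap (fun y => Real.sqrt (γt y)) x / Real.sqrt (γt x) + σat x / γt x =
          lap (fun y => Real.sqrt (γ y)) x / Real.sqrt (γ x) + σa x / γ x) →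
        c * L2norm X (fun x => Real.sqrt (γt x) - Real.sqrt (γ x)) ≤
            L2norm X (fun x => σat x - σa x) +
              L2norm X (fun x => Γt x * σat x - Γ x * σa x) ∧
          L2norm X (fun x => σat x - σa x) +
              L2norm X (fun x => Γt x * σat x - Γ x * σa x) ≤
            ct * (L2norm X (fun x => γt x - γ x) +
              L2norm X (fun x =>
                lap (fun y => Real.sqrt (γt y)) x / Real.sqrt (γt x) -
                  lap (fun y => Real.sqrt (γ y)) x / Real.sqrt (γ x))) := by
  have hb : 0 < ᾱ := by linarith
  have hsb : 0 < √ᾱ := Real.sqrt_pos.2 hb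
  have hK1 : 0 < √ᾱ / α ^ 2 := by positivity
  refine ⟨(2 * (√ᾱ / α ^ 2))⁻¹, 2 * (ᾱ / α + ᾱ) + 2 * (ᾱ ^ 2 / α), by positivity, by positivity, ?_⟩
  intro γ γt Γ Γt σa σat cγ cγt bγ bγt cΓ cΓt bΓ bΓt cσ cσt bσ bσt h1 h2
  have hX := hXopen.measurableSet
  have sub : X ⊆ closure X := subset_closure
  have z : L2norm X (fun _ => (0 : ℝ)) = 0 := by simp [L2norm]
  have i0 : IntegrableOn (fun x : Euc d => (0 : ℝ) ^ 2) X := by simp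
  have c1 := cγ.continuousOn
  have c2 := cγt.continuousOn
  have i1 : IntegrableOn (fun x => (Γt x * σat x - Γ x * σa x) ^ 2) X :=
    aux_int hXbd (((cΓt.mul cσt).sub (cΓ.mul cσ)).pow 2)
  have i2 : IntegrableOn (fun x => (γt x - γ x) ^ 2) X := aux_int hXbd ((c2.sub c1).pow 2)
  have i3 : IntegrableOn (fun x => (lap (fun y => √(γt y)) x / √(γt x) -
      lap (fun y => √(γ y)) x / √(γ x)) ^ 2) X := by
    have : IntegrableOn (fun x => (σa x / γ x - σat x / γt x) ^ 2) X := by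
      refine aux_int hXbd (((cσ.div c1 ?_).sub (cσt.div c2 ?_)).pow 2)
      · intro x hx; exact (hα.trans_le (bγ x hx).1).ne'
      · intro x hx; exact (hα.trans_le (bγt x hx).1).ne'
    refine this.congr_fun (fun x hx => ?_) hX
    have := h2 x hx
    simp only
    congr 1
    linarith
  constructor
  · have := aux_L2 (f := fun x => √(γt x) - √(γ x)) hX hK1.le i1 i0 (fun x hx => by
      have := (aux_pt hα (bγ x (sub hx)) (bγt x (sub hx)) (bΓ x (sub hx)) (bσ x (sub hx))
        (h1 x hx)).1
      simpa using this)
    rw [z, add_zero] at this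
    rw [inv_mul_le_iff₀ (by positivity)]
    refine this.trans ?_
    gcongr
    have : 0 ≤ L2norm X (fun x => σat x - σa x) :=
      Real.rpow_nonneg (integral_nonneg fun x => sq_nonneg _) _
    linarith
  · have a := aux_L2 (f := fun x => Γt x * σat x - Γ x * σa x) (K := ᾱ ^ 2 / α)
      hX (by positivity) i2 i3 (fun x hx => by
      have := (aux_pt hα (bγ x (sub hx)) (bγt x (sub hx)) (bΓ x (sub hx)) (bσ x (sub hx))
        (h1 x hx)).2
      refine this.trans ?_
      gcongr
      exact le_add_of_nonneg_right (abs_nonneg _))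
    have b := aux_L2 (f := fun x => σat x - σa x) (K := ᾱ / α + ᾱ)
      hX (by positivity) i2 i3 (fun x hx =>
        aux_pt2 hα (bγ x (sub hx)) (bγt x (sub hx)) (bσ x (sub hx)) (h2 x hx))
    rw [add_mul]
    exact add_le_add b a
end
end

section
/- Let X ⊂ ℝ^d (d ≥ 2) be a bounded open set with smooth boundary and let 0 < α ≤ ᾱ < ∞. There exist constants c₂ > 0 and c̃₂ > 0, depending only on X, d, α, ᾱ, such that the following holds: for all γ, γ̃ ∈ C²(X̄) with α ≤ γ, γ̃ ≤ ᾱ, and all Γ, Γ̃, σ_a, σ̃_a continuous on X̄ with values in [α, ᾱ], if the two coefficient triples satisfy, pointwise on X, the relations (i) √γ̃/(Γ̃σ̃_a) = √γ/(Γσ_a) and (ii) Δ√γ̃/√γ̃ + σ̃_a/γ̃ = Δ√γ/√γ + σ_a/γ, then c₂ ‖σ̃_a − σ_a‖_{L²(X)} ≤ ‖Γ̃/√γ̃ − Γ/√γ‖_{L²(X)} + ‖(Δ√γ̃/√γ̃ − Δ√γ/√γ) + σ_a(1/γ̃ − 1/γ)‖_{L²(X)} ≤ c̃₂ ‖σ̃_a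 − σ_a‖_{L²(X)}. (This is the second part of the paper's Corollary 2.8, characterizing the impact of uncertainty in the absorption coefficient σ_a on the simultaneous reconstruction of (Γ, γ); relations (i) and (ii) encode that both triples reproduce the same internal data, since μ = √γ/(Γσ_a) and q = −(Δ√γ/√γ + σ_a/γ) are determined by the data.) -/
open MeasureTheory

noncomputable section

theorem L2norm_le_aux {d : ℕ} {X : Set (Euc d)} (hX : MeasurableSet X) {f g : Euc d → ℝ} {C : ℝ}
    (hC : 0 ≤ C) (hg : IntegrableOn (fun x => (g x) ^ 2) X)
    (h : ∀ x ∈ X, |f x| ≤ C * |g x|) : L2norm X f ≤ C * L2norm X g := by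
  unfold L2norm
  have h1 : ∫ x in X, (f x) ^ 2 ≤ ∫ x in X, C ^ 2 * (g x) ^ 2 := by
    apply integral_mono_of_nonneg
    · exact Filter.Eventually.of_forall fun x => sq_nonneg _
    · exact hg.const_mul _
    · refine (ae_restrict_iff' hX).2 (Filter.Eventually.of_forall fun x hx => ?_)
      have := pow_le_pow_left₀ (abs_nonneg _) (h x hx) 2
      simpa [mul_pow] using this
  rw [integral_const_mul] at h1
  simp only [← Real.sqrt_eq_rpow]
  calc _ ≤ _ := Real.sqrt_le_sqrt h1
    _ = _ := by rw [Real.sqrt_mul (sq_nonneg _), Real.sqrt_sq hC]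

/-- paper Cor 2.8, second part: impact of uncertainty in the absorption
coefficient σₐ on the simultaneous reconstruction of (Γ, γ), given that both
coefficient triples produce the same μ = √γ/(Γσₐ) and q = −(Δ√γ/√γ + σₐ/γ). -/
theorem absorption_uncertainty_two_sided
    (d : ℕ) (hd : 2 ≤ d) (X : Set (Euc d)) (hXopen : IsOpen X)
    (hXbd : Bornology.IsBounded X) (hXsm : HasSmoothBoundary X)
    (α ᾱ : ℝ) (hα : 0 < α) (hαᾱ : α ≤ ᾱ) :
    ∃ c₂ ct₂ : ℝ, 0 < c₂ ∧ 0 < ct₂ ∧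
      ∀ γ γt Γ Γt σa σat : Euc d → ℝ,
        ContDiffOn ℝ 2 γ (closure X) → ContDiffOn ℝ 2 γt (closure X) →
        (∀ x ∈ closure X, α ≤ γ x ∧ γ x ≤ ᾱ) →
        (∀ x ∈ closure X, α ≤ γt x ∧ γt x ≤ ᾱ) →
        ContinuousOn Γ (closure X) → ContinuousOn Γt (closure X) →
        (∀ x ∈ closure X, α ≤ Γ x ∧ Γ x ≤ ᾱ) →
        (∀ x ∈ closure X, α ≤ Γt x ∧ Γt x ≤ ᾱ) →
        ContinuousOn σa (closure X) → ContinuousOn σat (closure X) →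
        (∀ x ∈ closure X, α ≤ σa x ∧ σa x ≤ ᾱ) →
        (∀ x ∈ closure X, α ≤ σat x ∧ σat x ≤ ᾱ) →
        -- (i) √γ̃/(Γ̃σ̃ₐ) = √γ/(Γσₐ) on X
        (∀ x ∈ X, Real.sqrt (γt x) / (Γt x * σat x) = Real.sqrt (γ x) / (Γ x * σa x)) →
        -- (ii) Δ√γ̃/√γ̃ + σ̃ₐ/γ̃ = Δ√γ/√γ + σₐ/γ on X
        (∀ x ∈ X,
          lap (fun y => Real.sqrt (γt y)) x / Real.sqrt (γt x) + σat x / γt x =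
          lap (fun y => Real.sqrt (γ y)) x / Real.sqrt (γ x) + σa x / γ x) →
        c₂ * L2norm X (fun x => σat x - σa x) ≤
            L2norm X (fun x => Γt x / Real.sqrt (γt x) - Γ x / Real.sqrt (γ x)) +
              L2norm X (fun x =>
                (lap (fun y => Real.sqrt (γt y)) x / Real.sqrt (γt x) -
                    lap (fun y => Real.sqrt (γ y)) x / Real.sqrt (γ x)) +
                  σa x * (1 / γt x - 1 / γ x)) ∧
          L2norm X (fun x => Γt x / Real.sqrt (γt x) - Γ x / Real.sqrt (γ x)) +
              L2norm X (fun x =>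
                (lap (fun y => Real.sqrt (γt y)) x / Real.sqrt (γt x) -
                    lap (fun y => Real.sqrt (γ y)) x / Real.sqrt (γ x)) +
                  σa x * (1 / γt x - 1 / γ x)) ≤
            ct₂ * L2norm X (fun x => σat x - σa x) := by
  have hᾱ : 0 < ᾱ := hα.trans_le hαᾱ
  have hsα : 0 < Real.sqrt α := Real.sqrt_pos.2 hα
  refine ⟨1 / ᾱ, ᾱ / (Real.sqrt α * α) + 1 / α, by positivity, by positivity, ?_⟩
  intro γ γt Γ Γt σa σat hγc hγtc hγ hγt hΓc hΓtc hΓ hΓt hσc hσtc hσ hσt h1 h2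
  have hXm := hXopen.measurableSet
  have hcpt : IsCompact (closure X) := hXbd.isCompact_closure
  have hB : ∀ x ∈ X, (lap (fun y => Real.sqrt (γt y)) x / Real.sqrt (γt x) -
                    lap (fun y => Real.sqrt (γ y)) x / Real.sqrt (γ x)) +
                  σa x * (1 / γt x - 1 / γ x) = - (σat x - σa x) / γt x := by
    intro x hx
    have e := h2 x hx
    have e1 : σa x * (1 / γt x - 1 / γ x) = σa x / γt x - σa x / γ x := by ring
    have e2 : - (σat x - σa x) / γt x = σa x / γt x - σat x / γt x := by ring
    rw [e1, e2]; linarith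
  have hA : ∀ x ∈ X, Γt x / Real.sqrt (γt x) - Γ x / Real.sqrt (γ x)
      = - (σat x - σa x) * (Γ x / (Real.sqrt (γ x) * σat x)) := by
    intro x hx
    have hx' := subset_closure hx
    have p1 : 0 < Real.sqrt (γ x) := Real.sqrt_pos.2 (hα.trans_le (hγ x hx').1)
    have p2 : 0 < Real.sqrt (γt x) := Real.sqrt_pos.2 (hα.trans_le (hγt x hx').1)
    have p3 := hα.trans_le (hΓ x hx').1
    have p4 := hα.trans_le (hΓt x hx').1
    have p5 := hα.trans_le (hσ x hx').1
    have p6 := hα.trans_le (hσt x hx').1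
    have e := h1 x hx
    rw [div_eq_div_iff (by positivity) (by positivity)] at e
    field_simp
    linarith
  have hδi : IntegrableOn (fun x => (σat x - σa x) ^ 2) X :=
    (((hσtc.sub hσc).pow 2).integrableOn_compact hcpt).mono_set subset_closure
  have hBi : IntegrableOn (fun x => ((lap (fun y => Real.sqrt (γt y)) x / Real.sqrt (γt x) -
                    lap (fun y => Real.sqrt (γ y)) x / Real.sqrt (γ x)) +
                  σa x * (1 / γt x - 1 / γ x)) ^ 2) X := by
    have : IntegrableOn (fun x => (- (σat x - σa x) / γt x) ^ 2) X := by
      refine (ContinuousOn.integrableOn_compact hcpt ?_).mono_set subset_closure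
      exact (((hσtc.sub hσc).neg).div hγtc.continuousOn
        (fun x hx => (hα.trans_le (hγt x hx).1).ne')).pow 2
    refine this.congr_fun (fun x hx => ?_) hXm
    simp only [hB x hx]
  constructor
  · have hlow : L2norm X (fun x => σat x - σa x) ≤ ᾱ * L2norm X (fun x =>
                (lap (fun y => Real.sqrt (γt y)) x / Real.sqrt (γt x) -
                    lap (fun y => Real.sqrt (γ y)) x / Real.sqrt (γ x)) +
                  σa x * (1 / γt x - 1 / γ x)) := by
      refine L2norm_le_aux hXm hᾱ.le hBi (fun x hx => ?_)
      have hx' := subset_closure hx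
      have p := hα.trans_le (hγt x hx').1
      rw [hB x hx, abs_div, abs_neg, abs_of_pos p, ← mul_div_assoc, le_div_iff₀ p, mul_comm]
      exact mul_le_mul_of_nonneg_right (hγt x hx').2 (abs_nonneg _)
    have hn : 0 ≤ L2norm X (fun x => Γt x / Real.sqrt (γt x) - Γ x / Real.sqrt (γ x)) := by
      unfold L2norm
      exact Real.rpow_nonneg (integral_nonneg fun x => sq_nonneg _) _
    rw [one_div, inv_mul_le_iff₀ hᾱ, mul_add]
    exact hlow.trans (le_add_of_nonneg_left (mul_nonneg hᾱ.le hn))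
  · rw [add_mul]
    refine add_le_add ?_ ?_
    · refine L2norm_le_aux hXm (by positivity) hδi (fun x hx => ?_)
      have hx' := subset_closure hx
      have p1 : Real.sqrt α ≤ Real.sqrt (γ x) := Real.sqrt_le_sqrt (hγ x hx').1
      have p3 := hα.trans_le (hΓ x hx').1
      have p6 := (hσt x hx').1
      have p7 := hα.trans_le p6
      have p8 := hsα.trans_le p1
      rw [hA x hx, abs_mul, abs_neg, mul_comm]
      refine mul_le_mul_of_nonneg_right ?_ (abs_nonneg _)
      rw [abs_of_pos (by positivity)]
      exact div_le_div₀ hᾱ.le (hΓ x hx').2 (by positivity)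
        (mul_le_mul p1 p6 hα.le p8.le)
    · refine L2norm_le_aux hXm (by positivity) hδi (fun x hx => ?_)
      have hx' := subset_closure hx
      have p := hα.trans_le (hγt x hx').1
      rw [hB x hx, abs_div, abs_neg, abs_of_pos p, one_div, inv_mul_eq_div]
      exact div_le_div_of_nonneg_left (abs_nonneg _) hα (hγt x hx').1
end
end

section
/- Let X ⊂ ℝ^d (d ≥ 2) be a bounded open set with smooth boundary. Fix background coefficients γ_x, γ_m ∈ C²(X̄), σ_{a,xi}, σ_{a,m} ∈ C¹(X̄), Γ ∈ C¹(X̄) and η ∈ C¹(X̄), all bounded between positive constants α and ᾱ, with 0 < η ≤ η̄ < 1 on X. There exists a constant c > 0, depending only on X, d and these background coefficients and bounds, such that the following holds: for all σ_{a,xf}, σ̃_{a,xf} ∈ C¹(X̄) with α ≤ σ_{a,xf}, σ̃_{a,xf} ≤ ᾱ, suppose (u_x, u_m) is a classical solution of the full fPAT diffusion system with coefficient σ_{a,xf}, and (ũ_x, ũ_m) is a classical solution of the partially linearized system, namely −∇·(γ_x∇ũ_x) + σ_{a,xi}ũ_x = 0 and −∇·(γ_m∇ũ_m) + σ_{a,m}ũ_m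 = η σ̃_{a,xf} ũ_x in X (same boundary data: u_x = ũ_x = g_x, u_m = ũ_m = 0 on ∂X), and suppose both reproduce the same internal datum, i.e. Γ((σ_{a,xi} + (1−η)σ̃_{a,xf})ũ_x + σ_{a,m}ũ_m) = Γ((σ_{a,xi} + (1−η)σ_{a,xf})u_x + σ_{a,m}u_m) on X. Then ‖(σ̃_{a,xf} − σ_{a,xf})u_x‖_{L²(X)} ≤ c ‖σ_{a,xf} u_x‖_{L²(X)}. (This is the paper's Theorem 3.3 characterizing the reconstruction error caused by partial linearization of the fPAT model, i.e. by dropping σ_{a,xf} from the excitation equation.) -/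
open MeasureTheory

noncomputable section

lemma gradient_coord {d : ℕ} (f : Euc d → ℝ) (x : Euc d) (i : Fin d) :
    (gradient f x) i = fderiv ℝ f x (EuclideanSpace.single i (1 : ℝ)) := by
  rw [← inner_gradient_left, EuclideanSpace.inner_single_right]
  simp

/-- cutoff of the identity near zero -/
def cutId (n : ℕ) (t : ℝ) : ℝ := t * Real.smoothTransition (n * t ^ 2 - 1)

lemma cutId_contDiff (n : ℕ) : ContDiff ℝ 1 (cutId n) := by
  unfold cutId
  have h : ContDiff ℝ 1 Real.smoothTransition := Real.smoothTransition.contDiff (n := 1)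
  exact contDiff_id.mul (h.comp (by fun_prop))

lemma cutId_deriv_nonneg (n : ℕ) (t : ℝ) : 0 ≤ deriv (cutId n) t := by
  have h : ContDiff ℝ 1 Real.smoothTransition := Real.smoothTransition.contDiff (n := 1)
  have hd : Differentiable ℝ Real.smoothTransition := h.differentiable (by norm_num)
  have h1 : HasDerivAt (fun t : ℝ => (n : ℝ) * t ^ 2 - 1) (n * (2 * t)) t := by
    have := ((hasDerivAt_pow 2 t).const_mul (n : ℝ)).sub_const 1
    simpa using this
  have h2 := (hd (n * t ^ 2 - 1)).hasDerivAt.comp t h1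
  have h3 : HasDerivAt (cutId n) _ t := (hasDerivAt_id t).mul h2
  rw [h3.deriv]
  have h4 : 0 ≤ deriv Real.smoothTransition (n * t ^ 2 - 1) :=
    Real.smoothTransition.monotone.deriv_nonneg
  have h5 := Real.smoothTransition.nonneg (n * t ^ 2 - 1)
  simp only [id]
  have : t * (deriv Real.smoothTransition (n * t ^ 2 - 1) * (n * (2 * t)))
    = deriv Real.smoothTransition (n * t ^ 2 - 1) * (2 * n * t ^ 2) := by ring
  rw [this]
  positivity

lemma cutId_zero (n : ℕ) (t : ℝ) (h : n * t ^ 2 ≤ 1) : cutId n t = 0 := by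
  unfold cutId
  rw [Real.smoothTransition.zero_of_nonpos (by linarith), mul_zero]

lemma cutId_sq_le (n : ℕ) (t : ℝ) : cutId n t ^ 2 ≤ cutId n t * t := by
  unfold cutId
  have h5 := Real.smoothTransition.nonneg (n * t ^ 2 - 1)
  have h6 := Real.smoothTransition.le_one (n * t ^ 2 - 1)
  set s := Real.smoothTransition (n * t ^ 2 - 1)
  nlinarith [mul_nonneg (mul_nonneg h5 (sub_nonneg.2 h6)) (sq_nonneg t)]

lemma cutId_sq_le' (n : ℕ) (t : ℝ) : cutId n t ^ 2 ≤ t ^ 2 := by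
  nlinarith [cutId_sq_le n t, sq_nonneg (cutId n t - t)]

lemma cutId_tendsto (t : ℝ) :
    Filter.Tendsto (fun n : ℕ => cutId n t) Filter.atTop (nhds t) := by
  by_cases ht : t = 0
  · subst ht; simp [cutId]
  · have hp : 0 < t ^ 2 := by positivity
    obtain ⟨N, hN⟩ := exists_nat_gt (2 / t ^ 2)
    apply tendsto_const_nhds.congr'
    filter_upwards [Filter.eventually_ge_atTop N] with n hn
    unfold cutId
    have : (N : ℝ) ≤ n := by exact_mod_cast hn
    rw [div_lt_iff₀ hp] at hN
    rw [Real.smoothTransition.one_of_one_le (by nlinarith), mul_one]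

lemma integral_fderiv_zero {d : ℕ} (g : Euc d → ℝ) (hg : ContDiff ℝ 1 g)
    (hc : HasCompactSupport g) (v : Euc d) :
    Integrable (fun x => fderiv ℝ g x v) ∧ ∫ x, fderiv ℝ g x v = 0 := by
  have hi : Integrable (fun x => fderiv ℝ g x v) :=
    ((hg.continuous_fderiv (by norm_num)).clm_apply continuous_const).integrable_of_hasCompactSupport
      (hc.fderiv_apply (𝕜 := ℝ) v)
  refine ⟨hi, ?_⟩
  have := integral_mul_fderiv_eq_neg_fderiv_mul_of_integrable (μ := (volume : Measure (Euc d)))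
    (f := fun _ => (1 : ℝ)) (g := g) (v := v) (by simp) (by simpa using hi)
    (by simpa using hg.continuous.integrable_of_hasCompactSupport hc)
    (fun x _ => differentiableAt_const _) (fun x _ => (hg.differentiable (by norm_num)) x)
  simpa using this

lemma contDiffAt_coord {d : ℕ} {X : Set (Euc d)} (hX : IsOpen X) {γ w : Euc d → ℝ}
    (hγ : ContDiffOn ℝ 1 γ X) (hw : ContDiffOn ℝ 2 w X) {x : Euc d} (hx : x ∈ X) (i : Fin d) :
    ContDiffAt ℝ 1 (fun y => γ y * fderiv ℝ w y (EuclideanSpace.single i (1 : ℝ))) x := by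
  have h1 : ContDiffAt ℝ 1 γ x := hγ.contDiffAt (hX.mem_nhds hx)
  have h2 : ContDiffAt ℝ 1 (fderiv ℝ w) x :=
    (hw.contDiffAt (hX.mem_nhds hx)).fderiv_right (by norm_num)
  exact h1.mul (h2.clm_apply contDiffAt_const)

lemma vdiv_eq {d : ℕ} (γ w : Euc d → ℝ) (x : Euc d) :
    vdiv (fun y => γ y • gradient w y) x = ∑ i : Fin d,
      fderiv ℝ (fun y => γ y * fderiv ℝ w y (EuclideanSpace.single i (1 : ℝ))) x
        (EuclideanSpace.single i (1 : ℝ)) := by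
  unfold vdiv
  simp only [PiLp.smul_apply, gradient_coord, smul_eq_mul]

lemma vdiv_sub {d : ℕ} {X : Set (Euc d)} (hX : IsOpen X) {γ u v : Euc d → ℝ}
    (hγ : ContDiffOn ℝ 1 γ X) (hu : ContDiffOn ℝ 2 u X) (hv : ContDiffOn ℝ 2 v X)
    {x : Euc d} (hx : x ∈ X) :
    vdiv (fun y => γ y • gradient (fun z => u z - v z) y) x =
      vdiv (fun y => γ y • gradient u y) x - vdiv (fun y => γ y • gradient v y) x := by
  rw [vdiv_eq, vdiv_eq, vdiv_eq, ← Finset.sum_sub_distrib]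
  refine Finset.sum_congr rfl fun i _ => ?_
  have e : (fun y => γ y * fderiv ℝ (fun z => u z - v z) y (EuclideanSpace.single i (1 : ℝ)))
      =ᶠ[nhds x] (fun y => γ y * fderiv ℝ u y (EuclideanSpace.single i (1 : ℝ)) -
        γ y * fderiv ℝ v y (EuclideanSpace.single i (1 : ℝ))) := by
    filter_upwards [hX.mem_nhds hx] with y hy
    have h1 := (hu.contDiffAt (hX.mem_nhds hy)).differentiableAt (by norm_num)
    have h2 := (hv.contDiffAt (hX.mem_nhds hy)).differentiableAt (by norm_num)
    rw [fderiv_fun_sub h1 h2]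
    simp [mul_sub]
  rw [e.fderiv_eq, fderiv_fun_sub
    ((contDiffAt_coord hX hγ hu hx i).differentiableAt (by norm_num))
    ((contDiffAt_coord hX hγ hv hx i).differentiableAt (by norm_num))]
  simp

lemma sq_integrable {d : ℕ} {X : Set (Euc d)} (hb : Bornology.IsBounded X) {f : Euc d → ℝ}
    (hf : ContinuousOn f (closure X)) : IntegrableOn (fun x => f x ^ 2) X :=
  ((hf.pow 2).integrableOn_compact hb.isCompact_closure).mono_set subset_closure

lemma energy_aux {d : ℕ} {X : Set (Euc d)} (hX : IsOpen X) (hb : Bornology.IsBounded X)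
    {α : ℝ} (hα : 0 < α) {γ q w f : Euc d → ℝ}
    (hγ : ContDiffOn ℝ 1 γ X) (hγ0 : ∀ x ∈ X, 0 ≤ γ x) (hq : ∀ x ∈ X, α ≤ q x)
    (hw : ContDiffOn ℝ 2 w X) (hwc : ContinuousOn w (closure X))
    (hw0 : ∀ x ∈ frontier X, w x = 0) (hf : ContinuousOn f (closure X))
    (hpde : ∀ x ∈ X, -vdiv (fun y => γ y • gradient w y) x + q x * w x = f x) (n : ℕ) :
    ∫ x in X, (cutId n (w x)) ^ 2 ≤ (∫ x in X, (f x) ^ 2) / α ^ 2 := by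
  classical
  set e : Fin d → Euc d := fun i => EuclideanSpace.single i (1 : ℝ) with he
  set P : Fin d → Euc d → ℝ := fun i y => γ y * fderiv ℝ w y (e i) with hP
  set G : Fin d → Euc d → ℝ := fun i => X.indicator (fun y => cutId n (w y) * P i y) with hG
  set K : Set (Euc d) := closure X ∩ (fun x => (n : ℝ) * w x ^ 2) ⁻¹' Set.Ici 1 with hK
  have hKc : IsCompact K := by
    apply hb.isCompact_closure.of_isClosed_subset _ Set.inter_subset_left
    exact (continuousOn_const.mul (hwc.pow 2)).preimage_isClosed_of_isClosed isClosed_closure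
      isClosed_Ici
  have hKX : K ⊆ X := by
    rintro x ⟨hx1, hx2⟩
    by_contra hx
    have : x ∈ frontier X := by rw [hX.frontier_eq]; exact ⟨hx1, hx⟩
    simp only [Set.mem_preimage, hw0 x this, Set.mem_Ici] at hx2
    norm_num at hx2
  have hG0 : ∀ i, ∀ x ∉ K, G i x = 0 := by
    intro i x hx
    by_cases hxX : x ∈ X
    · have : n * w x ^ 2 ≤ 1 := by
        by_contra hlt
        exact hx ⟨subset_closure hxX, (not_le.1 hlt).le⟩
      simp [hG, hxX, cutId_zero n _ this]
    · simp [hG, hxX]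
  have hGe0 : ∀ i, ∀ x ∉ K, G i =ᶠ[nhds x] fun _ => 0 := by
    intro i x hx
    filter_upwards [hKc.isClosed.isOpen_compl.mem_nhds hx] with y hy using hG0 i y hy
  have hGeX : ∀ i, ∀ x ∈ X, G i =ᶠ[nhds x] fun y => cutId n (w y) * P i y := by
    intro i x hx
    filter_upwards [hX.mem_nhds hx] with y hy
    simp [hG, hy]
  have hPd : ∀ i, ∀ x ∈ X, ContDiffAt ℝ 1 (P i) x := fun i x hx => contDiffAt_coord hX hγ hw hx i
  have hwd : ∀ x ∈ X, ContDiffAt ℝ 1 w x := fun x hx =>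
    (hw.contDiffAt (hX.mem_nhds hx)).of_le (by norm_num)
  have hGd : ∀ i, ContDiff ℝ 1 (G i) := by
    intro i
    rw [contDiff_iff_contDiffAt]
    intro x
    by_cases hx : x ∈ X
    · exact (((cutId_contDiff n).contDiffAt.comp x (hwd x hx)).mul (hPd i x hx)).congr_of_eventuallyEq
        (hGeX i x hx)
    · exact contDiffAt_const.congr_of_eventuallyEq (hGe0 i x (fun h => hx (hKX h)))
  have hGs : ∀ i, HasCompactSupport (G i) := fun i => HasCompactSupport.intro hKc (hG0 i)
  have hI := fun i => integral_fderiv_zero (G i) (hGd i) (hGs i) (e i)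
  have hint : Integrable (fun x => ∑ i, fderiv ℝ (G i) x (e i)) :=
    integrable_finsetSum _ fun i _ => (hI i).1
  have hz : ∫ x in X, ∑ i, fderiv ℝ (G i) x (e i) = 0 := by
    rw [setIntegral_eq_integral_of_forall_compl_eq_zero, integral_finsetSum _ fun i _ => (hI i).1]
    · simp [fun i => (hI i).2]
    · intro x hx
      refine Finset.sum_eq_zero fun i _ => ?_
      rw [(hGe0 i x (fun h => hx (hKX h))).fderiv_eq]
      simp
  have hcw : IntegrableOn (fun x => cutId n (w x) ^ 2) X :=
    sq_integrable hb ((cutId_contDiff n).continuous.comp_continuousOn hwc)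
  have hff := sq_integrable hb hf
  have key : ∀ x ∈ X, α / 2 * cutId n (w x) ^ 2 - 1 / (2 * α) * f x ^ 2 ≤
      ∑ i, fderiv ℝ (G i) x (e i) := by
    intro x hx
    have hsum : ∑ i, fderiv ℝ (G i) x (e i) =
        cutId n (w x) * vdiv (fun y => γ y • gradient w y) x +
        deriv (cutId n) (w x) * (γ x * ∑ i, (fderiv ℝ w x (e i)) ^ 2) := by
      rw [vdiv_eq, Finset.mul_sum, Finset.mul_sum, Finset.mul_sum, ← Finset.sum_add_distrib]
      refine Finset.sum_congr rfl fun i _ => ?_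
      rw [(hGeX i x hx).fderiv_eq]
      have h1 : HasFDerivAt (fun y => cutId n (w y)) (deriv (cutId n) (w x) • fderiv ℝ w x) x :=
        (((cutId_contDiff n).differentiable (by norm_num)) (w x)).hasDerivAt.comp_hasFDerivAt x
          ((hwd x hx).differentiableAt (by norm_num)).hasFDerivAt
      have h2 := ((hPd i x hx).differentiableAt (by norm_num)).hasFDerivAt
      rw [show fderiv ℝ (fun y => cutId n (w y) * P i y) x = _ from (h1.mul h2).fderiv]
      simp [hP]
      ring
    rw [hsum]
    have hv : vdiv (fun y => γ y • gradient w y) x = q x * w x - f x := by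
      linarith [hpde x hx]
    rw [hv]
    have h1 : 0 ≤ deriv (cutId n) (w x) * (γ x * ∑ i, (fderiv ℝ w x (e i)) ^ 2) :=
      mul_nonneg (cutId_deriv_nonneg n _) (mul_nonneg (hγ0 x hx)
        (Finset.sum_nonneg fun i _ => sq_nonneg _))
    set c := cutId n (w x) with hc
    have h2 : c ^ 2 ≤ c * w x := cutId_sq_le n (w x)
    have h3 : α * c ^ 2 ≤ q x * (c * w x) := mul_le_mul (hq x hx) h2 (sq_nonneg _)
      (hα.le.trans (hq x hx))
    have h4 : c * f x ≤ α / 2 * c ^ 2 + 1 / (2 * α) * f x ^ 2 := by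
      have : α / 2 * c ^ 2 + 1 / (2 * α) * f x ^ 2 - c * f x = (α * c - f x) ^ 2 / (2 * α) := by
        field_simp; ring
      have h5 : 0 ≤ (α * c - f x) ^ 2 / (2 * α) := by positivity
      linarith
    nlinarith
  have hle := setIntegral_mono_on ((hcw.const_mul (α / 2)).sub (hff.const_mul (1 / (2 * α))))
    hint.integrableOn hX.measurableSet key
  simp only [Pi.sub_apply] at hle
  rw [hz, integral_sub (hcw.const_mul _) (hff.const_mul _), integral_const_mul,
    integral_const_mul] at hle
  rw [le_div_iff₀ (by positivity)]
  have h6 : 1 / (2 * α) * (∫ x in X, f x ^ 2) * (2 * α) = ∫ x in X, f x ^ 2 := by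
    field_simp
  nlinarith [mul_le_mul_of_nonneg_right hle (by positivity : 0 ≤ 2 * α)]

lemma energy {d : ℕ} {X : Set (Euc d)} (hX : IsOpen X) (hb : Bornology.IsBounded X)
    {α : ℝ} (hα : 0 < α) {γ q w f : Euc d → ℝ}
    (hγ : ContDiffOn ℝ 1 γ X) (hγ0 : ∀ x ∈ X, 0 ≤ γ x) (hq : ∀ x ∈ X, α ≤ q x)
    (hw : ContDiffOn ℝ 2 w X) (hwc : ContinuousOn w (closure X))
    (hw0 : ∀ x ∈ frontier X, w x = 0) (hf : ContinuousOn f (closure X))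
    (hpde : ∀ x ∈ X, -vdiv (fun y => γ y • gradient w y) x + q x * w x = f x) :
    ∫ x in X, (w x) ^ 2 ≤ (∫ x in X, (f x) ^ 2) / α ^ 2 := by
  have ht : Filter.Tendsto (fun n : ℕ => ∫ x in X, (cutId n (w x)) ^ 2) Filter.atTop
      (nhds (∫ x in X, (w x) ^ 2)) := by
    apply tendsto_integral_of_dominated_convergence (fun x => w x ^ 2)
    · intro n
      exact (sq_integrable hb ((cutId_contDiff n).continuous.comp_continuousOn hwc)).1
    · exact sq_integrable hb hwc
    · intro n
      refine Filter.Eventually.of_forall fun x => ?_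
      rw [Real.norm_of_nonneg (sq_nonneg _)]
      exact cutId_sq_le' n (w x)
    · exact Filter.Eventually.of_forall fun x => (cutId_tendsto (w x)).pow 2
  exact le_of_tendsto' ht fun n => energy_aux hX hb hα hγ hγ0 hq hw hwc hw0 hf hpde n

/-- paper Thm 3.3: reconstruction error of the fluorescence absorption
coefficient caused by partial linearization of the fPAT model (dropping σ_{a,xf}
from the excitation equation). -/
theorem fpat_partial_linearization_error
    (d : ℕ) (hd : 2 ≤ d) (X : Set (Euc d)) (hXopen : IsOpen X)
    (hXbd : Bornology.IsBounded X) (hXsm : HasSmoothBoundary X)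
    (α ᾱ ηbar : ℝ) (hα : 0 < α) (hαᾱ : α ≤ ᾱ) (hηbar : ηbar < 1)
    (γx γm σxi σm Γ η : Euc d → ℝ)
    (hγx : ContDiffOn ℝ 2 γx (closure X)) (hγm : ContDiffOn ℝ 2 γm (closure X))
    (hσxi : ContDiffOn ℝ 1 σxi (closure X)) (hσm : ContDiffOn ℝ 1 σm (closure X))
    (hΓ : ContDiffOn ℝ 1 Γ (closure X)) (hη : ContDiffOn ℝ 1 η (closure X))
    (hγxb : ∀ x ∈ closure X, α ≤ γx x ∧ γx x ≤ ᾱ)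
    (hγmb : ∀ x ∈ closure X, α ≤ γm x ∧ γm x ≤ ᾱ)
    (hσxib : ∀ x ∈ closure X, α ≤ σxi x ∧ σxi x ≤ ᾱ)
    (hσmb : ∀ x ∈ closure X, α ≤ σm x ∧ σm x ≤ ᾱ)
    (hΓb : ∀ x ∈ closure X, α ≤ Γ x ∧ Γ x ≤ ᾱ)
    (hηb : ∀ x ∈ closure X, 0 < η x ∧ η x ≤ ηbar) :
    ∃ c : ℝ, 0 < c ∧
      ∀ σxf σxft : Euc d → ℝ, ∀ gx ux um uxt umt : Euc d → ℝ,
        ContDiffOn ℝ 1 σxf (closure X) → ContDiffOn ℝ 1 σxft (closure X) →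
        (∀ x ∈ closure X, α ≤ σxf x ∧ σxf x ≤ ᾱ) →
        (∀ x ∈ closure X, α ≤ σxft x ∧ σxft x ≤ ᾱ) →
        -- (u_x, u_m) ∈ C²(X) ∩ C(X̄) solves the full fPAT system with σ_{a,xf}
        ContDiffOn ℝ 2 ux X → ContinuousOn ux (closure X) →
        ContDiffOn ℝ 2 um X → ContinuousOn um (closure X) →
        (∀ x ∈ X, -vdiv (fun y => γx y • gradient ux y) x +
            (σxi x + σxf x) * ux x = 0) →
        (∀ x ∈ X, -vdiv (fun y => γm y • gradient um y) x + σm x * um x =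
            η x * σxf x * ux x) →
        -- (ũ_x, ũ_m) ∈ C²(X) ∩ C(X̄) solves the partially linearized system with σ̃_{a,xf}
        ContDiffOn ℝ 2 uxt X → ContinuousOn uxt (closure X) →
        ContDiffOn ℝ 2 umt X → ContinuousOn umt (closure X) →
        (∀ x ∈ X, -vdiv (fun y => γx y • gradient uxt y) x + σxi x * uxt x = 0) →
        (∀ x ∈ X, -vdiv (fun y => γm y • gradient umt y) x + σm x * umt x =
            η x * σxft x * uxt x) →
        -- same boundary data
        (∀ x ∈ frontier X, ux x = gx x ∧ uxt x = gx x ∧ um x = 0 ∧ umt x = 0) →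
        -- same internal datum
        (∀ x ∈ X,
          Γ x * ((σxi x + (1 - η x) * σxft x) * uxt x + σm x * umt x) =
          Γ x * ((σxi x + (1 - η x) * σxf x) * ux x + σm x * um x)) →
        L2norm X (fun x => (σxft x - σxf x) * ux x) ≤
          c * L2norm X (fun x => σxf x * ux x) := by
  have hM1 : 0 < 1 - ηbar := by linarith
  have hᾱ : 0 < ᾱ := hα.trans_le hαᾱ
  obtain ⟨M, hM⟩ : ∃ M, M = ᾱ / (1 - ηbar) := ⟨_, rfl⟩
  have hMpos : 0 < M := by rw [hM]; positivity
  obtain ⟨C, hC⟩ : ∃ C, C = 2 * M ^ 2 * (M ^ 2 / α ^ 2 / α ^ 2) + 8 * (M + ᾱ) ^ 2 / α ^ 2 :=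
    ⟨_, rfl⟩
  have hCpos : 0 < C := by rw [hC]; positivity
  refine ⟨Real.sqrt C, Real.sqrt_pos.2 hCpos, ?_⟩
  intro σxf σxft gx ux um uxt umt hσxf hσxft hσxfb hσxftb hux huxc hum humc hpx hpm
    huxt huxtc humt humtc hpxt hpmt hbd hdat
  have sub : X ⊆ closure X := subset_closure
  have hη1 : ∀ x ∈ closure X, 0 < 1 - η x := fun x hx => by linarith [(hηb x hx).2]
  -- error of the excitation field
  have hW : ∫ x in X, (uxt x - ux x) ^ 2 ≤ (∫ x in X, (σxf x * ux x) ^ 2) / α ^ 2 := by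
    apply energy hXopen hXbd hα (γ := γx) (q := σxi) ((hγx.mono sub).of_le (by norm_num))
      (fun x hx => hα.le.trans (hγxb x (sub hx)).1) (fun x hx => (hσxib x (sub hx)).1)
      (huxt.sub hux) (huxtc.sub huxc) (fun x hx => by rw [(hbd x hx).1, (hbd x hx).2.1, sub_self])
      (hσxf.continuousOn.mul huxc)
    intro x hx
    rw [vdiv_sub hXopen ((hγx.mono sub).of_le (by norm_num)) huxt hux hx]
    show _ = σxf x * ux x
    linarith [hpx x hx, hpxt x hx]
  have hS : ∀ x ∈ X, (1 - η x) * (σxft x * uxt x - σxf x * ux x) =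
      -(σxi x * (uxt x - ux x) + σm x * (umt x - um x)) := by
    intro x hx
    have := mul_left_cancel₀ (hα.trans_le (hΓb x (sub hx)).1).ne' (hdat x hx)
    linarith
  have hcf : ContinuousOn (fun x => -(η x / (1 - η x) * σxi x) * (uxt x - ux x)) (closure X) :=
    (((hη.continuousOn.div (continuousOn_const.sub hη.continuousOn)
      (fun x hx => (hη1 x hx).ne')).mul hσxi.continuousOn).neg).mul (huxtc.sub huxc)
  have hV : ∫ x in X, (umt x - um x) ^ 2 ≤
      (∫ x in X, (-(η x / (1 - η x) * σxi x) * (uxt x - ux x)) ^ 2) / α ^ 2 := by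
    apply energy hXopen hXbd hα (γ := γm) (q := fun x => σm x / (1 - η x))
      ((hγm.mono sub).of_le (by norm_num))
      (fun x hx => hα.le.trans (hγmb x (sub hx)).1) ?_
      (humt.sub hum) (humtc.sub humc)
      (fun x hx => by rw [(hbd x hx).2.2.1, (hbd x hx).2.2.2, sub_self]) hcf
    · intro x hx
      rw [vdiv_sub hXopen ((hγm.mono sub).of_le (by norm_num)) humt hum hx]
      have h1 := hη1 x (sub hx)
      have h2 := hS x hx
      have h3 : σxft x * uxt x - σxf x * ux x =
        -(σxi x * (uxt x - ux x) + σm x * (umt x - um x)) / (1 - η x) := by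
        rw [eq_div_iff h1.ne']; linarith
      have h4 : -(vdiv (fun y => γm y • gradient umt y) x - vdiv (fun y => γm y • gradient um y) x)
        = η x * (σxft x * uxt x - σxf x * ux x) - σm x * (umt x - um x) := by
        linarith [hpm x hx, hpmt x hx]
      rw [h4, h3]
      field_simp
      ring
    · intro x hx
      have h1 := hη1 x (sub hx)
      have h2 := (hσmb x (sub hx)).1
      rw [le_div_iff₀ h1]
      nlinarith [(hηb x (sub hx)).1]
  have iw : IntegrableOn (fun x => (uxt x - ux x) ^ 2) X := sq_integrable hXbd (huxtc.sub huxc)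
  have iv : IntegrableOn (fun x => (umt x - um x) ^ 2) X := sq_integrable hXbd (humtc.sub humc)
  -- coefficient bounds
  have hdiv : ∀ x ∈ X, ∀ s, 0 ≤ s → s ≤ ᾱ → 0 ≤ s / (1 - η x) ∧ s / (1 - η x) ≤ M := by
    intro x hx s h0 h1
    refine ⟨div_nonneg h0 (hη1 x (sub hx)).le, ?_⟩
    rw [hM]
    exact div_le_div₀ hᾱ.le h1 hM1 (by linarith [(hηb x (sub hx)).2])
  have hF : ∫ x in X, (-(η x / (1 - η x) * σxi x) * (uxt x - ux x)) ^ 2 ≤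
      M ^ 2 * ∫ x in X, (uxt x - ux x) ^ 2 := by
    rw [← integral_const_mul]
    refine setIntegral_mono_on (sq_integrable hXbd hcf) (iw.const_mul _) hXopen.measurableSet ?_
    intro x hx
    have hs := hσxib x (sub hx)
    have he := hηb x (sub hx)
    have h := hdiv x hx (η x * σxi x) (mul_nonneg he.1.le (hα.le.trans hs.1)) (by nlinarith)
    have e : η x / (1 - η x) * σxi x = η x * σxi x / (1 - η x) := by ring
    rw [e, mul_pow, neg_sq]
    exact mul_le_mul_of_nonneg_right (pow_le_pow_left₀ h.1 h.2 2) (sq_nonneg _)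
  have hT : ∫ x in X, ((σxft x - σxf x) * ux x) ^ 2 ≤
      8 * (M + ᾱ) ^ 2 * (∫ x in X, (uxt x - ux x) ^ 2) +
        2 * M ^ 2 * ∫ x in X, (umt x - um x) ^ 2 := by
    rw [← integral_const_mul, ← integral_const_mul, ← integral_add (iw.const_mul _) (iv.const_mul _)]
    refine setIntegral_mono_on (sq_integrable hXbd
      ((hσxft.continuousOn.sub hσxf.continuousOn).mul huxc))
      ((iw.const_mul _).add (iv.const_mul _)) hXopen.measurableSet ?_
    intro x hx
    have hs := hσxib x (sub hx)
    have hm := hσmb x (sub hx)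
    have ht := hσxftb x (sub hx)
    have h1 := hη1 x (sub hx)
    obtain ⟨a0, a1⟩ := hdiv x hx (σxi x) (hα.le.trans hs.1) hs.2
    obtain ⟨b0, b1⟩ := hdiv x hx (σm x) (hα.le.trans hm.1) hm.2
    have e : (σxft x - σxf x) * ux x = -((σxi x / (1 - η x) + σxft x) * (uxt x - ux x)
        + σm x / (1 - η x) * (umt x - um x)) := by
      have h2 := hS x hx
      field_simp
      linarith
    rw [e, neg_sq]
    set a := σxi x / (1 - η x) + σxft x with ha
    set b := σm x / (1 - η x)
    set w := uxt x - ux x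
    set v := umt x - um x
    have p1 : a ^ 2 ≤ (M + ᾱ) ^ 2 := pow_le_pow_left₀ (by linarith) (by linarith) 2
    have p2 : b ^ 2 ≤ M ^ 2 := pow_le_pow_left₀ b0 b1 2
    have q1 := mul_le_mul_of_nonneg_right p1 (sq_nonneg w)
    have q2 := mul_le_mul_of_nonneg_right p2 (sq_nonneg v)
    have q3 : 0 ≤ a ^ 2 * w ^ 2 := by positivity
    nlinarith [sq_nonneg (a * w - b * v)]
  unfold L2norm
  rw [← Real.sqrt_eq_rpow, ← Real.sqrt_eq_rpow, ← Real.sqrt_mul hCpos.le]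
  apply Real.sqrt_le_sqrt
  set A := ∫ x in X, (σxf x * ux x) ^ 2
  have hV2 : ∫ x in X, (umt x - um x) ^ 2 ≤ M ^ 2 * (A / α ^ 2) / α ^ 2 :=
    hV.trans (div_le_div_of_nonneg_right
      (hF.trans (mul_le_mul_of_nonneg_left hW (by positivity))) (by positivity))
  calc _ ≤ _ := hT
    _ ≤ 8 * (M + ᾱ) ^ 2 * (A / α ^ 2) + 2 * M ^ 2 * (M ^ 2 * (A / α ^ 2) / α ^ 2) :=
      add_le_add (mul_le_mul_of_nonneg_left hW (by positivity))
        (mul_le_mul_of_nonneg_left hV2 (by positivity))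
    _ = C * A := by rw [hC]; ring
end
end

section
/- Let X ⊂ ℝ^d (d ≥ 2) be an open set, γ ∈ C¹(X), σ_a : X → ℝ continuous, and let u₁, u₂ ∈ C²(X) satisfy −∇·(γ∇u_j) + σ_a u_j = 0 in X for j = 1, 2, with u₁(x) > 0 for all x ∈ X. Then the ratio u₂/u₁ satisfies the divergence-free transport equation ∇·( γ u₁² ∇(u₂/u₁) ) = 0 at every point of X. (This is the transport equation for the ratio of two photon density solutions derived in the proof of the paper's Theorem 2.4; it underlies the reconstruction of the quantity μ = √γ/(Γσ_a) from two internal data.) -/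
open MeasureTheory

noncomputable section

theorem grad_apply_aux {d : ℕ} (f : Euc d → ℝ) (y : Euc d) (i : Fin d) :
    (gradient f y) i = fderiv ℝ f y (EuclideanSpace.single i (1 : ℝ)) := by
  have h : inner ℝ (gradient f y) (EuclideanSpace.single i (1 : ℝ))
      = fderiv ℝ f y (EuclideanSpace.single i (1 : ℝ)) := by
    unfold gradient
    exact InnerProductSpace.toDual_symm_apply
  rw [← h, EuclideanSpace.inner_single_right]
  simp

/-- proof of paper Thm 2.4: the ratio u₂/u₁ of two solutions of the
PAT diffusion equation −∇·(γ∇u) + σₐu = 0 satisfies ∇·(γu₁²∇(u₂/u₁)) = 0. -/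
theorem ratio_transport_equation
    (d : ℕ) (hd : 2 ≤ d) (X : Set (Euc d)) (hXopen : IsOpen X)
    (γ : Euc d → ℝ) (hγ : ContDiffOn ℝ 1 γ X)
    (σa : Euc d → ℝ) (hσa : ContinuousOn σa X)
    (u₁ u₂ : Euc d → ℝ) (hu₁ : ContDiffOn ℝ 2 u₁ X) (hu₂ : ContDiffOn ℝ 2 u₂ X)
    (hu₁pos : ∀ x ∈ X, 0 < u₁ x)
    (heq₁ : ∀ x ∈ X, -vdiv (fun y => γ y • gradient u₁ y) x + σa x * u₁ x = 0)
    (heq₂ : ∀ x ∈ X, -vdiv (fun y => γ y • gradient u₂ y) x + σa x * u₂ x = 0) :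
    ∀ x ∈ X,
      vdiv (fun y => (γ y * (u₁ y) ^ 2) • gradient (fun z => u₂ z / u₁ z) y) x = 0 := by
  intro x hx
  have hXn : ∀ y ∈ X, X ∈ nhds y := fun y hy => hXopen.mem_nhds hy
  have hd1 : ∀ y ∈ X, DifferentiableAt ℝ u₁ y := fun y hy =>
    (hu₁.contDiffAt (hXn y hy)).differentiableAt (by norm_num)
  have hd2 : ∀ y ∈ X, DifferentiableAt ℝ u₂ y := fun y hy =>
    (hu₂.contDiffAt (hXn y hy)).differentiableAt (by norm_num)
  have hγd : DifferentiableAt ℝ γ x :=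
    (hγ.contDiffAt (hXn x hx)).differentiableAt (by norm_num)
  have hg : ∀ u : Euc d → ℝ, ContDiffOn ℝ 2 u X → ∀ i : Fin d,
      DifferentiableAt ℝ (fun y => γ y * fderiv ℝ u y (EuclideanSpace.single i (1 : ℝ))) x := by
    intro u hu i
    have h1 : ContDiffAt ℝ 1 (fderiv ℝ u) x :=
      (hu.contDiffAt (hXn x hx)).fderiv_right (by norm_num)
    have h2 : DifferentiableAt ℝ (fderiv ℝ u) x := h1.differentiableAt (by norm_num)
    exact hγd.mul (h2.clm_apply (differentiableAt_const _))
  have key : ∀ i : Fin d,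
      fderiv ℝ (fun y => ((γ y * (u₁ y) ^ 2) • gradient (fun z => u₂ z / u₁ z) y) i) x
        (EuclideanSpace.single i (1 : ℝ))
      = u₁ x * fderiv ℝ (fun y => (γ y • gradient u₂ y) i) x (EuclideanSpace.single i (1 : ℝ))
      - u₂ x * fderiv ℝ (fun y => (γ y • gradient u₁ y) i) x
        (EuclideanSpace.single i (1 : ℝ)) := by
    intro i
    simp only [PiLp.smul_apply, smul_eq_mul, grad_apply_aux]
    have hE : (fun y => γ y * (u₁ y) ^ 2 *
          fderiv ℝ (fun z => u₂ z / u₁ z) y (EuclideanSpace.single i (1 : ℝ))) =ᶠ[nhds x]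
        (fun y => u₁ y * (γ y * fderiv ℝ u₂ y (EuclideanSpace.single i (1 : ℝ)))
          - u₂ y * (γ y * fderiv ℝ u₁ y (EuclideanSpace.single i (1 : ℝ)))) := by
      filter_upwards [hXn x hx] with y hy
      have hne : u₁ y ≠ 0 := (hu₁pos y hy).ne'
      have hqd : DifferentiableAt ℝ (fun z => u₂ z / u₁ z) y := by
        simp only [div_eq_mul_inv]
        exact (hd2 y hy).mul ((hd1 y hy).inv hne)
      have hloc : u₂ =ᶠ[nhds y] (fun z => (u₂ z / u₁ z) * u₁ z) := by
        filter_upwards [hXn y hy] with z hz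
        rw [div_mul_cancel₀ _ (hu₁pos z hz).ne']
      have hp : fderiv ℝ (fun z => (u₂ z / u₁ z) * u₁ z) y = _ :=
        (hqd.hasFDerivAt.mul (hd1 y hy).hasFDerivAt).fderiv
      rw [hloc.fderiv_eq, hp]
      simp only [add_apply, smul_apply, smul_eq_mul]
      field_simp
      ring
    rw [hE.fderiv_eq]
    have A := (hd1 x hx).hasFDerivAt.mul (hg u₂ hu₂ i).hasFDerivAt
    have B := (hd2 x hx).hasFDerivAt.mul (hg u₁ hu₁ i).hasFDerivAt
    have C : fderiv ℝ (fun y => u₁ y * (γ y * fderiv ℝ u₂ y (EuclideanSpace.single i (1 : ℝ)))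
          - u₂ y * (γ y * fderiv ℝ u₁ y (EuclideanSpace.single i (1 : ℝ)))) x = _ :=
      (A.sub B).fderiv
    rw [C]
    simp only [sub_apply, add_apply, smul_apply, smul_eq_mul]
    ring
  have e1 := heq₁ x hx
  have e2 := heq₂ x hx
  unfold vdiv at e1 e2 ⊢
  rw [Finset.sum_congr rfl (fun i _ => key i), Finset.sum_sub_distrib, ← Finset.mul_sum,
    ← Finset.mul_sum]
  linear_combination (-u₁ x) * e2 + u₂ x * e1
end
end
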